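/- There exists N₀ such that for every N ≥ N₀ there exists a 2^N-outcome POVM M on (ℂ²)^{⊗N} ≅ ℂ^{2^N} with R_{Sep(N)}(M) ≥ 0.7 · 2^N / (8N²) − 1, where Sep(N) is the set of 2^N-outcome POVMs all of whose effects are N-qubit separable. -/

import Mathlib

open scoped BigOperators ComplexOrder

/-- A POVM with outcome set `κ` on the Hilbert space with orthonormal basis indexed by `ι`:
a tuple of positive semidefinite matrices summing to `1`. -/
def IsPOVM {ι κ : Type*} [Fintype ι] [DecidableEq ι] [Fintype κ]
    (M : κ → Matrix ι ι ℂ) : Prop :=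
  (∀ k, (M k).PosSemidef) ∧ ∑ k, M k = 1

/-- An elementary product operator on `N` qubits: an `N`-fold Kronecker product
`A_1 ⊗ ⋯ ⊗ A_N` of positive semidefinite `2×2` matrices. -/
def IsProdPSD {N : ℕ} (X : Matrix (Fin N → Fin 2) (Fin N → Fin 2) ℂ) : Prop :=
  ∃ A : Fin N → Matrix (Fin 2) (Fin 2) ℂ,
    (∀ t, (A t).PosSemidef) ∧ ∀ x y, X x y = ∏ t, A t (x t) (y t)

/-- An `N`-qubit separable operator: a finite sum of elementary product operators. -/
def IsNSep {N : ℕ} (X : Matrix (Fin N → Fin 2) (Fin N → Fin 2) ℂ) : Prop :=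
  ∃ (k : ℕ) (Y : Fin k → Matrix (Fin N → Fin 2) (Fin N → Fin 2) ℂ),
    (∀ i, IsProdPSD (Y i)) ∧ X = ∑ i, Y i

/-- The set of `n`-outcome separable POVMs on `N` qubits. -/
def SepPOVM (N n : ℕ) : Set (Fin n → Matrix (Fin N → Fin 2) (Fin N → Fin 2) ℂ) :=
  {M | IsPOVM M ∧ ∀ i, IsNSep (M i)}

/-- The set of admissible noise parameters `s ≥ 0` for which some POVM `N` makes
`(M + s N)/(1+s)` a member of `F`. -/
def robustnessSet {ι κ : Type*} [Fintype ι] [DecidableEq ι] [Fintype κ]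
    (F : Set (κ → Matrix ι ι ℂ)) (M : κ → Matrix ι ι ℂ) : Set ℝ :=
  {s : ℝ | 0 ≤ s ∧ ∃ N, IsPOVM N ∧
    (fun k => (1 + s)⁻¹ • (M k + s • N k)) ∈ F}

/-- The robustness of `M` with respect to `F`. -/
noncomputable def robustness {ι κ : Type*} [Fintype ι] [DecidableEq ι] [Fintype κ]
    (F : Set (κ → Matrix ι ι ℂ)) (M : κ → Matrix ι ι ℂ) : ℝ :=
  sInf (robustnessSet F M)

lemma exists_signs_exp_le {ι J : Type*} [Fintype ι] [DecidableEq ι] (s : Finset J) (a : J → ι → ℝ)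
    (ha : ∀ j ∈ s, ∑ x, a j x ^ 2 ≤ 1) (T : ℝ) :
    ∃ f : ι → ℝ, (∀ x, f x = 1 ∨ f x = -1) ∧
      ∀ j ∈ s, Real.exp (T * ∑ x, f x * a j x) ≤ s.card * Real.exp (T ^ 2 / 2) := by
  set P : Finset (ι → ℝ) := Fintype.piFinset fun _ => {1, -1} with hP
  have hsum : ∀ j ∈ s, ∑ f ∈ P, Real.exp (T * ∑ x, f x * a j x)
      ≤ P.card * Real.exp (T ^ 2 / 2) := by
    intro j hj
    have h1 : ∑ f ∈ P, Real.exp (T * ∑ x, f x * a j x)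
        = ∏ x, ∑ ε ∈ ({1, -1} : Finset ℝ), Real.exp (T * (ε * a j x)) := by
      rw [Finset.prod_univ_sum]
      refine Finset.sum_congr rfl fun f _ => ?_
      rw [Finset.mul_sum, Real.exp_sum]
    have h2 : ∀ x, ∑ ε ∈ ({1, -1} : Finset ℝ), Real.exp (T * (ε * a j x))
        ≤ 2 * Real.exp (T ^ 2 / 2 * a j x ^ 2) := by
      intro x
      rw [Finset.sum_pair (by norm_num)]
      have := Real.cosh_le_exp_half_sq (T * a j x)
      rw [Real.cosh_eq] at this
      have e1 : T * (1 * a j x) = T * a j x := by ring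
      have e2 : T * (-1 * a j x) = -(T * a j x) := by ring
      have e3 : T ^ 2 / 2 * a j x ^ 2 = (T * a j x) ^ 2 / 2 := by ring
      rw [e1, e2, e3]
      linarith
    have hc : (P.card : ℝ) = 2 ^ Fintype.card ι := by
      rw [hP, Fintype.card_piFinset]
      simp [Finset.card_pair (show (1 : ℝ) ≠ -1 by norm_num)]
    rw [h1, hc]
    calc _ ≤ ∏ x, 2 * Real.exp (T ^ 2 / 2 * a j x ^ 2) :=
          Finset.prod_le_prod (fun x _ => Finset.sum_nonneg fun _ _ => (Real.exp_pos _).le)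
            fun x _ => h2 x
      _ = 2 ^ Fintype.card ι * Real.exp (T ^ 2 / 2 * ∑ x, a j x ^ 2) := by
          rw [Finset.prod_mul_distrib, ← Real.exp_sum, ← Finset.mul_sum]; simp
      _ ≤ _ := by
          gcongr
          exact mul_le_of_le_one_right (by positivity) (ha j hj)
  have htot : ∑ f ∈ P, ∑ j ∈ s, Real.exp (T * ∑ x, f x * a j x)
      ≤ ∑ f ∈ P, s.card * Real.exp (T ^ 2 / 2) := by
    rw [Finset.sum_comm]
    refine (Finset.sum_le_sum hsum).trans (le_of_eq ?_)
    simp only [Finset.sum_const, nsmul_eq_mul]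
    ring
  have hne : P.Nonempty := Fintype.piFinset_nonempty.2 fun _ => by simp
  obtain ⟨f, hf, hle⟩ := Finset.exists_le_of_sum_le hne htot
  refine ⟨f, fun x => ?_, fun j hj => le_trans ?_ hle⟩
  · simpa using Fintype.mem_piFinset.1 hf x
  · exact Finset.single_le_sum (f := fun j => Real.exp (T * ∑ x, f x * a j x))
      (fun _ _ => (Real.exp_pos _).le) hj

lemma exists_int_round_toward_zero {m : ℕ} (hm : 0 < m) {x : ℝ} (hx : |x| ≤ 1) :
    ∃ k ∈ Finset.Icc (-(m : ℤ)) m, |(k : ℝ) / m| ≤ |x| ∧ |x - k / m| ≤ 1 / m := by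
  have hm' : (0 : ℝ) < m := by exact_mod_cast hm
  wlog h : 0 ≤ x generalizing x
  · obtain ⟨k, hk, h1, h2⟩ := this (x := -x) (by rwa [abs_neg]) (by linarith)
    refine ⟨-k, ?_, ?_, ?_⟩
    · rw [Finset.mem_Icc] at hk ⊢; omega
    · rw [abs_neg] at h1; rwa [Int.cast_neg, neg_div, abs_neg]
    · rw [← abs_neg]; convert h2 using 2; push_cast; ring
  rw [abs_of_nonneg h] at hx ⊢
  have hf0 : 0 ≤ ⌊m * x⌋ := Int.floor_nonneg.2 (by positivity)
  have hf0' : (0 : ℝ) ≤ ⌊m * x⌋ := by exact_mod_cast hf0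
  have hle := Int.floor_le (m * x)
  have hlt := Int.lt_floor_add_one (m * x)
  have hfm : ⌊m * x⌋ ≤ m := by
    have : (⌊m * x⌋ : ℝ) ≤ m := hle.trans (by nlinarith)
    exact_mod_cast this
  have hq : (⌊m * x⌋ : ℝ) / m ≤ x := by rw [div_le_iff₀ hm']; linarith
  refine ⟨⌊m * x⌋, by rw [Finset.mem_Icc]; omega, ?_, ?_⟩
  · rwa [abs_of_nonneg (by positivity)]
  · rw [abs_of_nonneg (by linarith), sub_le_iff_le_add, ← add_div, le_div_iff₀ hm']
    linarith

lemma exists_finset_approx_unit_disc {m : ℕ} (hm : 0 < m) :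
    ∃ R : Finset ℂ, R.card ≤ (2 * m + 1) ^ 2 ∧
      ∀ z : ℂ, ‖z‖ ≤ 1 → ∃ w ∈ R, ‖w‖ ≤ ‖z‖ ∧ ‖z - w‖ ≤ 2 / m := by
  classical
  let I := Finset.Icc (-(m : ℤ)) m
  refine ⟨(I ×ˢ I).image fun p => (⟨(p.1 : ℝ) / m, (p.2 : ℝ) / m⟩ : ℂ), ?_, fun z hz => ?_⟩
  · refine Finset.card_image_le.trans (le_of_eq ?_)
    rw [Finset.card_product, Int.card_Icc, sq]
    congr 1 <;> omega
  · obtain ⟨k, hk, hk1, hk2⟩ := exists_int_round_toward_zero hm ((Complex.abs_re_le_norm z).trans hz)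
    obtain ⟨l, hl, hl1, hl2⟩ := exists_int_round_toward_zero hm ((Complex.abs_im_le_norm z).trans hz)
    refine ⟨_, Finset.mem_image_of_mem _ (Finset.mk_mem_product hk hl), ?_, ?_⟩
    · rw [Complex.norm_def, Complex.norm_def, Complex.normSq_apply, Complex.normSq_apply]
      apply Real.sqrt_le_sqrt
      exact add_le_add (abs_le_iff_mul_self_le.1 hk1) (abs_le_iff_mul_self_le.1 hl1)
    · refine (Complex.norm_le_abs_re_add_abs_im _).trans ?_
      simp only [Complex.sub_re, Complex.sub_im]
      calc _ ≤ 1 / (m : ℝ) + 1 / m := add_le_add hk2 hl2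
        _ = _ := by ring

lemma norm_prod_sub_prod_le_sum {ι : Type*} (s : Finset ι) (a b : ι → ℂ)
    (ha : ∀ i ∈ s, ‖a i‖ ≤ 1) (hb : ∀ i ∈ s, ‖b i‖ ≤ 1) :
    ‖∏ i ∈ s, a i - ∏ i ∈ s, b i‖ ≤ ∑ i ∈ s, ‖a i - b i‖ := by
  classical
  induction s using Finset.induction_on with
  | empty => simp
  | insert i s hi ih =>
    rw [Finset.prod_insert hi, Finset.prod_insert hi, Finset.sum_insert hi]
    simp only [Finset.mem_insert, forall_eq_or_imp] at ha hb
    have hs : ‖∏ i ∈ s, a i‖ ≤ 1 := by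
      rw [norm_prod]
      exact Finset.prod_le_one (fun _ _ => norm_nonneg _) ha.2
    calc ‖a i * ∏ i ∈ s, a i - b i * ∏ i ∈ s, b i‖
        = ‖(a i - b i) * ∏ i ∈ s, a i + b i * (∏ i ∈ s, a i - ∏ i ∈ s, b i)‖ := by
          congr 1; ring
      _ ≤ ‖a i - b i‖ * ‖∏ i ∈ s, a i‖ + ‖b i‖ * ‖∏ i ∈ s, a i - ∏ i ∈ s, b i‖ := by
          refine (norm_add_le _ _).trans (le_of_eq ?_)
          rw [norm_mul, norm_mul]
      _ ≤ ‖a i - b i‖ + ∑ i ∈ s, ‖a i - b i‖ :=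
          add_le_add (mul_le_of_le_one_right (norm_nonneg _) hs)
            ((mul_le_of_le_one_left (norm_nonneg _) hb.1).trans (ih ha.2 hb.2))

lemma sum_prod_apply_eq_prod_sum {N : ℕ} {R : Type*} [CommSemiring R] (h : Fin N → Fin 2 → R) :
    ∑ x : Fin N → Fin 2, ∏ t, h t (x t) = ∏ t, ∑ i, h t i := by
  rw [Finset.prod_univ_sum, Fintype.piFinset_univ]

lemma eventually_sq_le_exp :
    ∃ N₀ : ℕ, ∀ N : ℕ, N₀ ≤ N → 1 ≤ N ∧
      ((2 * (2 * N * 2 ^ N) + 1 : ℕ) : ℝ) ^ 2 ≤ Real.exp (2 * N - 1) := by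
  have he : 2 < Real.exp 1 := by linarith [Real.exp_one_gt_d9]
  have hr : 1 < Real.exp 1 / 2 := by rw [lt_div_iff₀ (by norm_num)]; linarith
  have ht := tendsto_pow_const_div_const_pow_of_one_lt 1 hr
  have hev := ht.eventually (gt_mem_nhds (show (0 : ℝ) < 1 / 10 by norm_num))
  obtain ⟨N₀, hN₀⟩ := Filter.eventually_atTop.1 hev
  refine ⟨max N₀ 1, fun N hN => ⟨le_of_max_le_right hN, ?_⟩⟩
  have h := hN₀ N (le_of_max_le_left hN)
  have hN1 : (1 : ℝ) ≤ N := by exact_mod_cast le_of_max_le_right hN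
  rw [pow_one, div_lt_iff₀ (by positivity), div_pow, ← Real.exp_nat_mul, mul_one] at h
  have h2 : (1 : ℝ) ≤ 2 ^ N := one_le_pow₀ (by norm_num)
  have h3 : 10 * N * 2 ^ N < Real.exp N := by
    have : (N : ℝ) * 2 ^ N < 1 / 10 * Real.exp N := by
      have := mul_lt_mul_of_pos_right h (show (0 : ℝ) < 2 ^ N by positivity)
      rwa [mul_assoc, div_mul_cancel₀ _ (by positivity)] at this
    linarith
  have h4 : ((2 * (2 * N * 2 ^ N) + 1 : ℕ) : ℝ) ≤ Real.exp N / 2 := by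
    push_cast
    nlinarith
  have h5 : Real.exp (2 * N - 1) = Real.exp N ^ 2 / Real.exp 1 := by
    rw [Real.exp_sub, ← Real.exp_nat_mul]; norm_num
  rw [h5, le_div_iff₀ (Real.exp_pos _)]
  calc _ ≤ (Real.exp N / 2) ^ 2 * 4 := by
        gcongr
        linarith [Real.exp_one_lt_d9]
    _ = _ := by ring

lemma exists_signs_re_sum_le {N : ℕ} (hN : 1 ≤ N)
    (hexp : ((2 * (2 * N * 2 ^ N) + 1 : ℕ) : ℝ) ^ 2 ≤ Real.exp (2 * N - 1)) :
    ∃ f : (Fin N → Fin 2) → ℝ, (∀ x, f x = 1 ∨ f x = -1) ∧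
      ∀ φ : Fin N → Fin 2 → ℂ, (∀ t, ∑ i, ‖φ t i‖ ^ 2 ≤ 1) →
        (∑ x, (f x : ℂ) * ∏ t, φ t (x t)).re ≤ 3 * N := by
  classical
  have hN0 : (0 : ℝ) < N := by exact_mod_cast hN
  obtain ⟨R, hRcard, hR⟩ := exists_finset_approx_unit_disc (m := 2 * N * 2 ^ N) (by positivity)
  let net : Finset (Fin N → Fin 2 → ℂ) :=
    (Fintype.piFinset fun _ => Fintype.piFinset fun _ => R).filter
      fun w => ∀ t, ∑ i, ‖w t i‖ ^ 2 ≤ 1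
  have hnet : (net.card : ℝ) ≤ Real.exp (4 * N ^ 2 - 2 * N) := by
    have h1 : net.card ≤ (R.card ^ 2) ^ N := by
      refine (Finset.card_filter_le _ _).trans (le_of_eq ?_)
      simp
    calc (net.card : ℝ) ≤ ((R.card : ℝ) ^ 2) ^ N := by exact_mod_cast h1
      _ ≤ (Real.exp (2 * N - 1) ^ 2) ^ N := by
          gcongr
          refine le_trans ?_ hexp
          exact_mod_cast hRcard
      _ = _ := by
          rw [← pow_mul, ← Real.exp_nat_mul]
          congr 1
          push_cast
          ring
  obtain ⟨f, hf, hfnet⟩ := exists_signs_exp_le net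
    (fun w (x : Fin N → Fin 2) => (∏ t, w t (x t)).re) (fun w hw => by
      calc ∑ x : Fin N → Fin 2, (∏ t, w t (x t)).re ^ 2
          ≤ ∑ x : Fin N → Fin 2, ∏ t, ‖w t (x t)‖ ^ 2 := by
            refine Finset.sum_le_sum fun x _ => ?_
            rw [Finset.prod_pow, ← norm_prod, ← sq_abs]
            gcongr
            exact Complex.abs_re_le_norm _
        _ = ∏ t, ∑ i, ‖w t i‖ ^ 2 := sum_prod_apply_eq_prod_sum fun t i => ‖w t i‖ ^ 2
        _ ≤ 1 := Finset.prod_le_one (fun _ _ => by positivity)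
            fun t _ => (Finset.mem_filter.1 hw).2 t) (2 * N)
  refine ⟨f, hf, fun φ hφ => ?_⟩
  have hφ1 : ∀ t i, ‖φ t i‖ ≤ 1 := fun t i => by
    have := (Finset.single_le_sum (f := fun i => ‖φ t i‖ ^ 2)
      (fun _ _ => by positivity) (Finset.mem_univ i)).trans (hφ t)
    exact (sq_le_one_iff₀ (norm_nonneg _)).1 this
  choose w hwR hwφ hwd using fun t i => hR (φ t i) (hφ1 t i)
  have hw : w ∈ net := by
    refine Finset.mem_filter.2 ⟨?_, fun t => le_trans ?_ (hφ t)⟩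
    · simpa [Fintype.mem_piFinset] using hwR
    · exact Finset.sum_le_sum fun i _ => by gcongr; exact hwφ t i
  have hmain : ∑ x, f x * (∏ t, w t (x t)).re ≤ 3 * N - 1 := by
    have h := (hfnet w hw).trans (mul_le_mul_of_nonneg_right hnet (Real.exp_pos _).le)
    rw [← Real.exp_add, Real.exp_le_exp] at h
    nlinarith
  have hdiff : ∀ x : Fin N → Fin 2, (f x * ∏ t, φ t (x t) : ℂ).re
      ≤ f x * (∏ t, w t (x t)).re + 1 / 2 ^ N := by
    intro x
    have h1 : ‖∏ t, φ t (x t) - ∏ t, w t (x t)‖ ≤ 1 / 2 ^ N := by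
      refine (norm_prod_sub_prod_le_sum _ _ _ (fun t _ => hφ1 t _)
        fun t _ => (hwφ t _).trans (hφ1 t _)).trans
        ((Finset.sum_le_sum fun t _ => hwd t (x t)).trans (le_of_eq ?_))
      simp only [Finset.sum_const, Finset.card_univ, Fintype.card_fin, nsmul_eq_mul]
      push_cast
      field_simp
    have h2 : |f x| = 1 := by rcases hf x with h | h <;> simp [h]
    have h3 : (f x * ∏ t, φ t (x t) : ℂ).re - f x * (∏ t, w t (x t)).re
        = f x * (∏ t, φ t (x t) - ∏ t, w t (x t)).re := by
      rw [Complex.re_ofReal_mul, Complex.sub_re]; ring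
    have h4 : f x * (∏ t, φ t (x t) - ∏ t, w t (x t)).re ≤ 1 / 2 ^ N := by
      refine (le_abs_self _).trans ?_
      rw [abs_mul, h2, one_mul]
      exact (Complex.abs_re_le_norm _).trans h1
    linarith
  rw [Complex.re_sum]
  refine (Finset.sum_le_sum fun x _ => hdiff x).trans ?_
  rw [Finset.sum_add_distrib]
  have : ∑ _x : Fin N → Fin 2, (1 : ℝ) / 2 ^ N = 1 := by simp
  linarith

lemma norm_sum_sq_le_of_forall_re_sum_le {N : ℕ} (hN : 1 ≤ N) {f : (Fin N → Fin 2) → ℝ} {C : ℝ}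
    (hf : ∀ φ : Fin N → Fin 2 → ℂ, (∀ t, ∑ i, ‖φ t i‖ ^ 2 ≤ 1) →
      (∑ x, (f x : ℂ) * ∏ t, φ t (x t)).re ≤ C) (φ : Fin N → Fin 2 → ℂ) :
    ‖∑ x, (f x : ℂ) * ∏ t, φ t (x t)‖ ^ 2 ≤ C ^ 2 * ∏ t, ∑ i, ‖φ t i‖ ^ 2 := by
  by_cases h0 : ∃ t, ∑ i, ‖φ t i‖ ^ 2 = 0
  · obtain ⟨t, ht⟩ := h0
    have hφ : ∀ i, φ t i = 0 := fun i => by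
      have := (Finset.sum_eq_zero_iff_of_nonneg (fun _ _ => by positivity)).1 ht i
        (Finset.mem_univ i)
      simpa using this
    have hz : ∑ x, (f x : ℂ) * ∏ t, φ t (x t) = 0 :=
      Finset.sum_eq_zero fun x _ => by
        rw [Finset.prod_eq_zero (Finset.mem_univ t) (hφ _), mul_zero]
    rw [hz, Finset.prod_eq_zero (Finset.mem_univ t) ht]
    simp
  push Not at h0
  have hpos : ∀ t, 0 < ∑ i, ‖φ t i‖ ^ 2 := fun t =>
    lt_of_le_of_ne (by positivity) (h0 t).symm
  set n : Fin N → ℝ := fun t => Real.sqrt (∑ i, ‖φ t i‖ ^ 2) with hn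
  have hnpos : ∀ t, 0 < n t := fun t => Real.sqrt_pos.2 (hpos t)
  have hnsq : ∀ t, n t ^ 2 = ∑ i, ‖φ t i‖ ^ 2 := fun t => Real.sq_sqrt (hpos t).le
  set z := ∑ x, (f x : ℂ) * ∏ t, φ t (x t) with hz
  obtain ⟨c, hc, hcz⟩ : ∃ c : ℂ, ‖c‖ = 1 ∧ c * z = ‖z‖ := by
    by_cases h : z = 0
    · exact ⟨1, by simp, by simp [h]⟩
    · have hz' : (‖z‖ : ℂ) ≠ 0 := by simpa using h
      refine ⟨‖z‖ / z, by simp [h], by field_simp⟩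
  have key := hf (fun t i => (if t = ⟨0, hN⟩ then c else 1) * ((n t : ℂ)⁻¹ * φ t i)) (fun t => by
    have h1 : ‖(if t = ⟨0, hN⟩ then c else 1)‖ = 1 := by split_ifs <;> simp [hc]
    simp only [norm_mul, h1, one_mul, mul_pow, ← Finset.mul_sum, ← hnsq]
    rw [norm_inv, Complex.norm_real, Real.norm_of_nonneg (hnpos t).le, ← mul_pow,
      inv_mul_cancel₀ (hnpos t).ne', one_pow])
  have hsum : ∑ x, (f x : ℂ) * ∏ t, ((if t = ⟨0, hN⟩ then c else 1) * ((n t : ℂ)⁻¹ * φ t (x t)))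
      = ((‖z‖ * (∏ t, n t)⁻¹ : ℝ) : ℂ) := by
    push_cast
    rw [← hcz, hz, Finset.mul_sum, Finset.sum_mul]
    refine Finset.sum_congr rfl fun x _ => ?_
    simp only [Finset.prod_mul_distrib, Finset.prod_ite_eq', Finset.mem_univ, if_true,
      Finset.prod_inv_distrib]
    ring
  have hP : 0 < ∏ t, n t := Finset.prod_pos fun t _ => hnpos t
  rw [hsum, Complex.ofReal_re, ← div_eq_mul_inv, div_le_iff₀ hP] at key
  simp only [← hnsq]
  rw [Finset.prod_pow, ← mul_pow]
  gcongr

lemma IsPOVM.one_sub_posSemidef {ι κ : Type*} [Fintype ι] [DecidableEq ι] [Fintype κ]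
    {M : κ → Matrix ι ι ℂ} (hM : IsPOVM M) (k : κ) : (1 - M k).PosSemidef := by
  classical
  rw [← hM.2, ← Finset.add_sum_erase _ _ (Finset.mem_univ k), add_sub_cancel_left]
  exact Matrix.posSemidef_sum _ fun j _ => hM.1 j

lemma mem_robustnessSet_of_uniform_mem {ι κ : Type*} [Fintype ι] [DecidableEq ι] [Fintype κ]
    {F : Set (κ → Matrix ι ι ℂ)} {M : κ → Matrix ι ι ℂ} (hM : IsPOVM M)
    (hκ : 1 < Fintype.card κ)
    (hF : (fun _ => (Fintype.card κ : ℝ)⁻¹ • (1 : Matrix ι ι ℂ)) ∈ F) :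
    (Fintype.card κ : ℝ) - 1 ∈ robustnessSet F M := by
  have hs : (0 : ℝ) < Fintype.card κ - 1 := by
    have : (1 : ℝ) < Fintype.card κ := by exact_mod_cast hκ
    linarith
  refine ⟨hs.le, fun k => ((Fintype.card κ : ℝ) - 1)⁻¹ • (1 - M k), ⟨fun k => ?_, ?_⟩, ?_⟩
  · exact (hM.one_sub_posSemidef k).smul (inv_nonneg.2 hs.le)
  · rw [← Finset.smul_sum, Finset.sum_sub_distrib, hM.2, Finset.sum_const, Finset.card_univ,
      ← Nat.cast_smul_eq_nsmul ℝ]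
    nth_rw 2 [← one_smul ℝ (1 : Matrix ι ι ℂ)]
    rw [← sub_smul, smul_smul, inv_mul_cancel₀ hs.ne', one_smul]
  · convert hF using 2 with k
    rw [smul_smul, mul_inv_cancel₀ hs.ne', one_smul, add_sub_cancel, add_sub_cancel]

lemma isNSep_uniform (N : ℕ) :
    IsNSep (((2 : ℝ) ^ N)⁻¹ • (1 : Matrix (Fin N → Fin 2) (Fin N → Fin 2) ℂ)) := by
  refine ⟨1, fun _ => _, fun _ => ⟨fun _ => (2 : ℝ)⁻¹ • 1, fun _ =>
    Matrix.PosSemidef.one.smul (by norm_num), fun x y => ?_⟩, by simp; rfl⟩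
  simp only [Matrix.smul_apply, Matrix.one_apply, smul_ite, smul_zero]
  rw [Finset.prod_ite_zero]
  simp [funext_iff]

lemma uniform_mem_sepPOVM (N : ℕ) :
    (fun _ => ((2 : ℝ) ^ N)⁻¹ • (1 : Matrix (Fin N → Fin 2) (Fin N → Fin 2) ℂ))
      ∈ SepPOVM N (2 ^ N) := by
  refine ⟨⟨fun _ => Matrix.PosSemidef.one.smul (by positivity), ?_⟩, fun _ => isNSep_uniform N⟩
  rw [Finset.sum_const, Finset.card_univ, Fintype.card_fin, ← Nat.cast_smul_eq_nsmul ℝ, smul_smul]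
  simp

open scoped MatrixOrder in
lemma IsProdPSD.re_dotProduct_mulVec_le {N : ℕ}
    {S : Matrix (Fin N → Fin 2) (Fin N → Fin 2) ℂ} (hS : IsProdPSD S)
    {g : (Fin N → Fin 2) → ℝ} {C : ℝ}
    (hg : ∀ φ : Fin N → Fin 2 → ℂ,
      ‖∑ x, (g x : ℂ) * ∏ t, φ t (x t)‖ ^ 2 ≤ C * ∏ t, ∑ i, ‖φ t i‖ ^ 2) :
    (star (fun x => (g x : ℂ)) ⬝ᵥ S.mulVec fun x => (g x : ℂ)).re ≤ C * S.trace.re := by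
  obtain ⟨A, hA, hSA⟩ := hS
  have hB : ∀ t, ∃ B : Matrix (Fin 2) (Fin 2) ℂ, A t = star B * B := fun t =>
    CStarAlgebra.nonneg_iff_eq_star_mul_self.mp (hA t).nonneg
  choose B hB using hB
  have hentry : ∀ x y, S x y = ∑ k : Fin N → Fin 2,
      star (∏ t, B t (k t) (x t)) * ∏ t, B t (k t) (y t) := by
    intro x y
    rw [hSA]
    simp only [hB, Matrix.mul_apply, Matrix.star_apply]
    rw [← sum_prod_apply_eq_prod_sum fun t k => star (B t k (x t)) * B t k (y t)]
    simp [Finset.prod_mul_distrib]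
  have hquad : star (fun x => (g x : ℂ)) ⬝ᵥ S.mulVec (fun x => (g x : ℂ))
      = ((∑ k : Fin N → Fin 2, ‖∑ x, (g x : ℂ) * ∏ t, B t (k t) (x t)‖ ^ 2 : ℝ) : ℂ) := by
    have hk : ∀ z : ℂ, ((‖z‖ ^ 2 : ℝ) : ℂ) = star z * z := fun z => by
      rw [Complex.star_def, Complex.conj_mul', Complex.ofReal_pow]
    rw [Complex.ofReal_sum]
    simp only [hk, star_sum, Finset.sum_mul_sum]
    rw [Finset.sum_comm]
    refine Finset.sum_congr rfl fun x _ => ?_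
    rw [Finset.sum_comm, Matrix.mulVec, dotProduct, Finset.mul_sum]
    refine Finset.sum_congr rfl fun y _ => ?_
    rw [hentry, Finset.sum_mul, Finset.mul_sum]
    refine Finset.sum_congr rfl fun k _ => ?_
    rw [star_mul', Pi.star_apply]
    ring
  have htrace : S.trace = ((∑ k : Fin N → Fin 2, ∏ t, ∑ i, ‖B t (k t) i‖ ^ 2 : ℝ) : ℂ) := by
    rw [sum_prod_apply_eq_prod_sum fun t k => ∑ i, ‖B t k i‖ ^ 2]
    simp only [Matrix.trace, Matrix.diag, hSA]
    rw [sum_prod_apply_eq_prod_sum fun t i => A t i i]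
    push_cast
    refine Finset.prod_congr rfl fun t _ => ?_
    rw [Finset.sum_comm]
    simp only [hB, Matrix.mul_apply, Matrix.star_apply, ← Complex.conj_mul', Complex.star_def]
  rw [hquad, htrace, Complex.ofReal_re, Complex.ofReal_re, Finset.mul_sum]
  exact Finset.sum_le_sum fun k _ => hg fun t => B t (k t)

lemma IsNSep.re_dotProduct_mulVec_le {N : ℕ}
    {S : Matrix (Fin N → Fin 2) (Fin N → Fin 2) ℂ} (hS : IsNSep S)
    {g : (Fin N → Fin 2) → ℝ} {C : ℝ}
    (hg : ∀ φ : Fin N → Fin 2 → ℂ,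
      ‖∑ x, (g x : ℂ) * ∏ t, φ t (x t)‖ ^ 2 ≤ C * ∏ t, ∑ i, ‖φ t i‖ ^ 2) :
    (star (fun x => (g x : ℂ)) ⬝ᵥ S.mulVec fun x => (g x : ℂ)).re ≤ C * S.trace.re := by
  obtain ⟨k, Y, hY, rfl⟩ := hS
  rw [Matrix.sum_mulVec, dotProduct_sum, Matrix.trace_sum, Complex.re_sum, Complex.re_sum,
    Finset.mul_sum]
  exact Finset.sum_le_sum fun i _ => (hY i).re_dotProduct_mulVec_le hg

/-- The character `x ↦ (-1) ^ (a · x)` of `(ℤ/2)^N`. -/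
def bitChar {N : ℕ} (a x : Fin N → Fin 2) : ℝ := ∏ t, (-1) ^ ((a t : ℕ) * (x t : ℕ))

lemma bitChar_mul_self {N : ℕ} (a x : Fin N → Fin 2) : bitChar a x * bitChar a x = 1 := by
  rw [bitChar, ← Finset.prod_mul_distrib]
  refine Finset.prod_eq_one fun t _ => ?_
  rw [← mul_pow]; simp

lemma sum_bitChar_mul {N : ℕ} (x y : Fin N → Fin 2) :
    ∑ a, bitChar a x * bitChar a y = if x = y then 2 ^ N else 0 := by
  simp only [bitChar, ← Finset.prod_mul_distrib]
  rw [sum_prod_apply_eq_prod_sum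
    fun t i => (-1 : ℝ) ^ ((i : ℕ) * (x t : ℕ)) * (-1) ^ ((i : ℕ) * (y t : ℕ))]
  have h : ∀ i j : Fin 2, ∑ k : Fin 2, (-1 : ℝ) ^ ((k : ℕ) * (i : ℕ)) * (-1) ^ ((k : ℕ) * (j : ℕ))
      = if i = j then 2 else 0 := by
    intro i j
    fin_cases i <;> fin_cases j <;> norm_num [Fin.sum_univ_two]
  simp only [h]
  rw [Finset.prod_ite_zero]
  simp [funext_iff]

/-- The rank-one effect of the orthonormal basis vector with amplitudes
`2 ^ (-N / 2) f(x) (-1) ^ (a · x)`. -/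
noncomputable def signEffect {N : ℕ} (f : (Fin N → Fin 2) → ℝ) (a : Fin N → Fin 2) :
    Matrix (Fin N → Fin 2) (Fin N → Fin 2) ℂ :=
  ((2 : ℝ) ^ N)⁻¹ • Matrix.vecMulVec (fun x => ((f x * bitChar a x : ℝ) : ℂ))
    (star fun x => ((f x * bitChar a x : ℝ) : ℂ))

lemma isPOVM_signEffect {N : ℕ} {f : (Fin N → Fin 2) → ℝ} (hf : ∀ x, f x * f x = 1) :
    IsPOVM (signEffect f) := by
  refine ⟨fun a => (Matrix.posSemidef_vecMulVec_self_star _).smul (by positivity), ?_⟩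
  ext x y
  have h : ∑ a, (2 ^ N : ℝ)⁻¹ * ((f x * bitChar a x) * (f y * bitChar a y))
      = if x = y then 1 else 0 := by
    calc _ = (2 ^ N : ℝ)⁻¹ * (f x * f y * ∑ a, bitChar a x * bitChar a y) := by
          rw [Finset.mul_sum, Finset.mul_sum]
          exact Finset.sum_congr rfl fun a _ => by ring
      _ = _ := by
          rw [sum_bitChar_mul]
          split_ifs with hxy
          · subst hxy; rw [hf]; field_simp
          · simp
  have h' := congrArg (fun r : ℝ => (r : ℂ)) h
  simpa [Matrix.sum_apply, signEffect, Matrix.vecMulVec_apply, Matrix.one_apply, apply_ite] using h'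

lemma dotProduct_signEffect_mulVec {N : ℕ} {f : (Fin N → Fin 2) → ℝ} (hf : ∀ x, f x * f x = 1)
    (a : Fin N → Fin 2) :
    star (fun x => ((f x * bitChar a x : ℝ) : ℂ)) ⬝ᵥ
      (signEffect f a).mulVec (fun x => ((f x * bitChar a x : ℝ) : ℂ)) = 2 ^ N := by
  set v : (Fin N → Fin 2) → ℂ := fun x => ((f x * bitChar a x : ℝ) : ℂ) with hv
  have hvv : star v ⬝ᵥ v = 2 ^ N := by
    have : ∀ x, star (v x) * v x = 1 := fun x => by
      rw [hv, Complex.star_def, Complex.conj_ofReal, ← Complex.ofReal_mul, mul_mul_mul_comm, hf,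
        bitChar_mul_self]
      simp
    simp only [dotProduct, Pi.star_apply, this]
    simp
  rw [signEffect, Matrix.smul_mulVec, Matrix.vecMulVec_mulVec, ← hv, hvv, dotProduct_smul]
  simp [dotProduct_smul, hvv]

lemma norm_sum_mul_bitChar_sq_le {N : ℕ} {f : (Fin N → Fin 2) → ℝ} {C : ℝ}
    (hf : ∀ φ : Fin N → Fin 2 → ℂ,
      ‖∑ x, (f x : ℂ) * ∏ t, φ t (x t)‖ ^ 2 ≤ C * ∏ t, ∑ i, ‖φ t i‖ ^ 2)
    (a : Fin N → Fin 2) (φ : Fin N → Fin 2 → ℂ) :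
    ‖∑ x, ((f x * bitChar a x : ℝ) : ℂ) * ∏ t, φ t (x t)‖ ^ 2 ≤ C * ∏ t, ∑ i, ‖φ t i‖ ^ 2 := by
  have h := hf fun t i => (-1) ^ ((a t : ℕ) * (i : ℕ)) * φ t i
  convert h using 4 with x
  · rw [Finset.prod_mul_distrib, bitChar]
    push_cast
    ring
  · simp

lemma le_of_mem_robustnessSet_signEffect {N n : ℕ} {f : (Fin N → Fin 2) → ℝ} {C : ℝ}
    (hsign : ∀ x, f x * f x = 1)
    (hf : ∀ φ : Fin N → Fin 2 → ℂ,
      ‖∑ x, (f x : ℂ) * ∏ t, φ t (x t)‖ ^ 2 ≤ C * ∏ t, ∑ i, ‖φ t i‖ ^ 2)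
    (e : Fin n ≃ (Fin N → Fin 2)) {s : ℝ}
    (hs : s ∈ robustnessSet (SepPOVM N n) fun k => signEffect f (e k)) :
    (2 : ℝ) ^ N ≤ (1 + s) * C := by
  obtain ⟨hs0, P, hP, hSep⟩ := hs
  have hk : ∀ k, (1 + s)⁻¹ * 2 ^ N
      ≤ C * ((1 + s)⁻¹ • (signEffect f (e k) + s • P k)).trace.re := by
    intro k
    refine le_trans ?_ ((hSep.2 k).re_dotProduct_mulVec_le (norm_sum_mul_bitChar_sq_le hf (e k)))
    have h0 := (Complex.nonneg_iff.1
      ((hP.1 k).dotProduct_mulVec_nonneg fun x => ((f x * bitChar (e k) x : ℝ) : ℂ))).1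
    rw [Matrix.smul_mulVec, Matrix.add_mulVec, Matrix.smul_mulVec, dotProduct_smul, dotProduct_add,
      dotProduct_signEffect_mulVec hsign, dotProduct_smul, Complex.smul_re, Complex.add_re,
      Complex.smul_re, smul_eq_mul, smul_eq_mul]
    have h2 : ((2 : ℂ) ^ N).re = 2 ^ N := by
      rw [← Complex.ofReal_ofNat, ← Complex.ofReal_pow, Complex.ofReal_re]
    rw [h2]
    gcongr
    exact le_add_of_nonneg_right (mul_nonneg hs0 h0)
  have hsum := Finset.sum_le_sum fun k (_ : k ∈ Finset.univ) => hk k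
  rw [← Finset.mul_sum (s := Finset.univ) (a := C), ← Complex.re_sum, ← Matrix.trace_sum,
    hSep.1.2, Finset.sum_const, Finset.card_univ, Fintype.card_congr e, nsmul_eq_mul] at hsum
  have hpos : (0 : ℝ) < 2 ^ N := by positivity
  have hs1 : 0 < 1 + s := by linarith
  have hsum' : (2 : ℝ) ^ N * ((1 + s)⁻¹ * 2 ^ N) ≤ 2 ^ N * C := by
    simpa [Matrix.trace_one, mul_comm C, ← Complex.ofReal_ofNat, ← Complex.ofReal_pow] using hsum
  have := le_of_mul_le_mul_left hsum' hpos
  rwa [inv_mul_le_iff₀ hs1] at this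

/-- For all sufficiently many qubits `N` there is a `2^N`-outcome POVM whose robustness
with respect to separable POVMs is at least `0.7 · 2^N / (8N²) − 1`. -/
theorem exists_povm_robustness_sep_qubits_ge :
    ∃ N₀ : ℕ, ∀ N : ℕ, N₀ ≤ N →
      ∃ M : Fin (2 ^ N) → Matrix (Fin N → Fin 2) (Fin N → Fin 2) ℂ,
        IsPOVM M ∧
        0.7 * (2 : ℝ) ^ N / (8 * (N : ℝ) ^ 2) - 1 ≤ robustness (SepPOVM N (2 ^ N)) M := by
  obtain ⟨N₀, hN₀⟩ := eventually_sq_le_exp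
  refine ⟨N₀, fun N hN => ?_⟩
  obtain ⟨hN1, hexp⟩ := hN₀ N hN
  have hNpos : (0 : ℝ) < N := by exact_mod_cast hN1
  obtain ⟨f, hsign, hre⟩ := exists_signs_re_sum_le hN1 hexp
  have hsq : ∀ x, f x * f x = 1 := fun x => by rcases hsign x with h | h <;> simp [h]
  have hf := norm_sum_sq_le_of_forall_re_sum_le hN1 hre
  have hcard : Fintype.card (Fin (2 ^ N)) = Fintype.card (Fin N → Fin 2) := by simp
  let e : Fin (2 ^ N) ≃ (Fin N → Fin 2) := Fintype.equivOfCardEq hcard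
  have hM : IsPOVM fun k => signEffect f (e k) :=
    ⟨fun k => (isPOVM_signEffect hsq).1 (e k),
      (Equiv.sum_comp e (signEffect f)).trans (isPOVM_signEffect hsq).2⟩
  refine ⟨_, hM, le_csInf ⟨_, mem_robustnessSet_of_uniform_mem hM ?_ ?_⟩ fun s hs => ?_⟩
  · rw [Fintype.card_fin]; exact Nat.one_lt_two_pow (by omega)
  · simpa using uniform_mem_sepPOVM N
  · have h := le_of_mem_robustnessSet_signEffect hsq hf e hs
    have hs0 := hs.1
    rw [sub_le_iff_le_add', div_le_iff₀ (by positivity)]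
    nlinarith [mul_nonneg (by linarith : 0 ≤ 1 + s) (sq_nonneg (N : ℝ))]
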